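/- (Simulation of ΛZ(I⊗H) up to a Pauli operator, using one ancillary qubit) Work in (ℂ²)^{⊗3} with tensor factors ordered (a, b, c), where a, b carry the two-qubit input state Φ ∈ ℂ⁴ and c is the ancilla, prepared in |s₁⟩ by a Z-measurement with outcome s₁. For all s₁, s₂, s₃, s₄ ∈ {0,1} and every Φ ∈ ℂ⁴, there is a sign ε ∈ {+1, -1} (depending only on s₁,s₂,s₃,s₄) such that: (I ⊗ (I + (-1)^{s₄}σz)/2 ⊗ I) · ((I⊗I⊗I + (-1)^{s₃}·I⊗σx⊗σz)/2) · ((I⊗I⊗I + (-1)^{s₂}·σz⊗I⊗σx)/2) · (Φ ⊗ |s₁⟩) = ε · (1/(2√2)) · S₂₃ ( ((σz^{s₁+s₃} ⊗ σx^{s₃}σz^{s₂+s₄}) · ΛZ · (I⊗H) · Φ) ⊗ |s₄⟩ ), where S₂₃ is the unitary permutation of (ℂ²)^{⊗3} that swaps the second and third tensor factors. In other words, the measurement sequence Z_c, Z_a⊗X_c, Z_c⊗X_b, Z_b leaves qubits (a,c) in the state ΛZ(I⊗H)Φ up to a Pauli operator, with qubit b left in |s₄⟩, and every branch has squared norm ‖Φ‖²/8.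 -/

import Mathlib

open Matrix Complex
open scoped Real Kronecker

noncomputable section

/-- The Pauli matrix σx. -/
def σx : Matrix (Fin 2) (Fin 2) ℂ := !![0, 1; 1, 0]

/-- The Pauli matrix σz. -/
def σz : Matrix (Fin 2) (Fin 2) ℂ := !![1, 0; 0, -1]

/-- The Hadamard gate `H = (1/√2)·!![1,1;1,-1]`. -/
def Hgate : Matrix (Fin 2) (Fin 2) ℂ :=
  ((Real.sqrt 2 : ℂ))⁻¹ • !![1, 1; 1, -1]

/-- The controlled-Z gate `ΛZ = diag(1,1,1,-1)` on `ℂ²⊗ℂ²`. -/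
def CZ : Matrix (Fin 2 × Fin 2) (Fin 2 × Fin 2) ℂ :=
  Matrix.of fun p q => if p = q then (if p.1 = 1 ∧ p.2 = 1 then -1 else 1) else 0

/-- The computational basis vector `|s⟩` of ℂ². -/
def ket (s : Fin 2) : Fin 2 → ℂ := fun i => if i = s then 1 else 0

/-- The tensor product of a two-qubit vector with a one-qubit vector, giving a
three-qubit vector with factors ordered `(a, b, c)` (associated as `((a,b),c)`). -/
def tp3 (Φ : Fin 2 × Fin 2 → ℂ) (ψ : Fin 2 → ℂ) : (Fin 2 × Fin 2) × Fin 2 → ℂ :=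
  fun p => Φ p.1 * ψ p.2

/-- The unitary permutation of `(ℂ²)^{⊗3}` swapping the second and third tensor factors. -/
def swap23 (v : (Fin 2 × Fin 2) × Fin 2 → ℂ) : (Fin 2 × Fin 2) × Fin 2 → ℂ :=
  fun p => v ((p.1.1, p.2), p.1.2)

/-- Measuring `Z_a ⊗ X_c`, on amplitudes. -/
lemma measure_ZaXc_apply (r : ℂ) (v : (Fin 2 × Fin 2) × Fin 2 → ℂ) (a b c : Fin 2) :
    (((2 : ℂ)⁻¹ • ((1 : Matrix ((Fin 2 × Fin 2) × Fin 2) ((Fin 2 × Fin 2) × Fin 2) ℂ)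
      + r • ((σz ⊗ₖ (1 : Matrix (Fin 2) (Fin 2) ℂ)) ⊗ₖ σx))).mulVec v) ((a, b), c)
      = 2⁻¹ * (v ((a, b), c) + r * (-1) ^ (a : ℕ) * v ((a, b), c + 1)) := by
  rw [smul_mulVec, add_mulVec, one_mulVec, smul_mulVec]
  simp only [Pi.smul_apply, Pi.add_apply, smul_eq_mul, mulVec, dotProduct, Fintype.sum_prod_type,
    Fin.sum_univ_two, kroneckerMap_apply, Matrix.one_apply]
  fin_cases a <;> fin_cases b <;> fin_cases c <;> simp [σx, σz]

/-- Measuring `Z_c ⊗ X_b`, on amplitudes. -/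
lemma measure_ZcXb_apply (r : ℂ) (v : (Fin 2 × Fin 2) × Fin 2 → ℂ) (a b c : Fin 2) :
    (((2 : ℂ)⁻¹ • ((1 : Matrix ((Fin 2 × Fin 2) × Fin 2) ((Fin 2 × Fin 2) × Fin 2) ℂ)
      + r • (((1 : Matrix (Fin 2) (Fin 2) ℂ) ⊗ₖ σx) ⊗ₖ σz))).mulVec v) ((a, b), c)
      = 2⁻¹ * (v ((a, b), c) + r * (-1) ^ (c : ℕ) * v ((a, b + 1), c)) := by
  rw [smul_mulVec, add_mulVec, one_mulVec, smul_mulVec]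
  simp only [Pi.smul_apply, Pi.add_apply, smul_eq_mul, mulVec, dotProduct, Fintype.sum_prod_type,
    Fin.sum_univ_two, kroneckerMap_apply, Matrix.one_apply]
  fin_cases a <;> fin_cases b <;> fin_cases c <;> simp [σx, σz]

/-- Measuring `Z_b` projects onto the amplitudes whose second index is the outcome. -/
lemma measure_Zb_apply (s : Fin 2) (v : (Fin 2 × Fin 2) × Fin 2 → ℂ) (a b c : Fin 2) :
    ((((1 : Matrix (Fin 2) (Fin 2) ℂ) ⊗ₖ
        ((2 : ℂ)⁻¹ • ((1 : Matrix (Fin 2) (Fin 2) ℂ) + ((-1 : ℂ) ^ (s : ℕ)) • σz))) ⊗ₖ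
          (1 : Matrix (Fin 2) (Fin 2) ℂ)).mulVec v) ((a, b), c)
      = if b = s then v ((a, b), c) else 0 := by
  simp only [mulVec, dotProduct, Fintype.sum_prod_type, Fin.sum_univ_two, kroneckerMap_apply, Matrix.one_apply]
  fin_cases s <;> fin_cases a <;> fin_cases b <;> fin_cases c <;> norm_num [σz]

/-- The amplitudes of `(σz^i ⊗ σx^j σz^k) ΛZ (I ⊗ H) Φ`. -/
lemma pauli_CZ_H_apply (i j k : Fin 2) (Φ : Fin 2 × Fin 2 → ℂ) (a c : Fin 2) :
    ((((σz ^ (i : ℕ)) ⊗ₖ (σx ^ (j : ℕ) * σz ^ (k : ℕ))) * CZ *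
        ((1 : Matrix (Fin 2) (Fin 2) ℂ) ⊗ₖ Hgate)).mulVec Φ) (a, c)
      = (-1) ^ ((i * a + (k + a) * (c + j) : Fin 2) : ℕ) * ((Real.sqrt 2 : ℂ))⁻¹ *
          (Φ (a, 0) + (-1) ^ ((c + j : Fin 2) : ℕ) * Φ (a, 1)) := by
  rw [← mulVec_mulVec, ← mulVec_mulVec]
  simp only [mulVec, dotProduct, Fintype.sum_prod_type, Fin.sum_univ_two, kroneckerMap_apply, Matrix.one_apply]
  fin_cases i <;> fin_cases j <;> fin_cases k <;> fin_cases a <;> fin_cases c <;>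
    simp [σx, σz, CZ, Hgate] <;> ring

/-- `(σz^i ⊗ σx^j σz^k) ΛZ (I ⊗ H)` preserves the norm. -/
lemma sum_norm_sq_pauli_CZ_H (i j k : Fin 2) (Φ : Fin 2 × Fin 2 → ℂ) :
    ∑ q, ‖((((σz ^ (i : ℕ)) ⊗ₖ (σx ^ (j : ℕ) * σz ^ (k : ℕ))) * CZ *
        ((1 : Matrix (Fin 2) (Fin 2) ℂ) ⊗ₖ Hgate)).mulVec Φ) q‖ ^ 2 = ∑ q, ‖Φ q‖ ^ 2 := by
  have h (x y : ℂ) : ‖x + y‖ ^ 2 + ‖x - y‖ ^ 2 = 2 * (‖x‖ ^ 2 + ‖y‖ ^ 2) := by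
    simpa only [sq] using parallelogram_law_with_norm ℝ x y
  have h₀ := h (Φ (0, 0)) (Φ (0, 1))
  have h₁ := h (Φ (1, 0)) (Φ (1, 1))
  simp only [Fintype.sum_prod_type, pauli_CZ_H_apply, Fin.sum_univ_two, norm_mul, mul_pow,
    norm_pow, norm_neg, norm_one, one_pow, one_mul, norm_inv, inv_pow, Complex.norm_real,
    Real.norm_eq_abs, sq_abs, Real.sq_sqrt zero_le_two]
  fin_cases j <;> simp [← sub_eq_add_neg] <;> linarith

/-- Tensoring with `|s⟩` and permuting the tensor factors preserves the norm. -/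
lemma sum_norm_sq_swap23_tp3_ket (v : Fin 2 × Fin 2 → ℂ) (s : Fin 2) :
    ∑ p, ‖swap23 (tp3 v (ket s)) p‖ ^ 2 = ∑ q, ‖v q‖ ^ 2 := by
  simp only [Fintype.sum_prod_type, Fin.sum_univ_two, swap23, tp3, ket]
  fin_cases s <;> simp

/-- Simulation of `ΛZ(I⊗H)` up to a Pauli operator, using one ancillary qubit:
the measurement sequence `Z_c` (outcome `s₁`, preparing the ancilla), `Z_a⊗X_c`
(outcome `s₂`), `Z_c⊗X_b` (outcome `s₃`), `Z_b` (outcome `s₄`) applied to `Φ ⊗ |s₁⟩`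
yields, up to a sign `ε` and the factor `1/(2√2)`, the state
`(σz^{s₁+s₃} ⊗ σx^{s₃}σz^{s₂+s₄})·ΛZ·(I⊗H)·Φ` on qubits `(a,c)` with `|s₄⟩` on qubit `b`;
every branch has squared norm `‖Φ‖²/8`. -/
theorem cz_H_simulation (s₁ s₂ s₃ s₄ : Fin 2) :
    ∃ ε : ℂ, (ε = 1 ∨ ε = -1) ∧
      ∀ Φ : Fin 2 × Fin 2 → ℂ,
        ((((1 : Matrix (Fin 2) (Fin 2) ℂ) ⊗ₖ
              ((2 : ℂ)⁻¹ • ((1 : Matrix (Fin 2) (Fin 2) ℂ) + ((-1 : ℂ) ^ (s₄ : ℕ)) • σz))) ⊗ₖ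
            (1 : Matrix (Fin 2) (Fin 2) ℂ)).mulVec
          (((2 : ℂ)⁻¹ • ((1 : Matrix ((Fin 2 × Fin 2) × Fin 2) ((Fin 2 × Fin 2) × Fin 2) ℂ)
              + ((-1 : ℂ) ^ (s₃ : ℕ)) • (((1 : Matrix (Fin 2) (Fin 2) ℂ) ⊗ₖ σx) ⊗ₖ σz))).mulVec
            (((2 : ℂ)⁻¹ • ((1 : Matrix ((Fin 2 × Fin 2) × Fin 2) ((Fin 2 × Fin 2) × Fin 2) ℂ)
                + ((-1 : ℂ) ^ (s₂ : ℕ)) •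
                    ((σz ⊗ₖ (1 : Matrix (Fin 2) (Fin 2) ℂ)) ⊗ₖ σx))).mulVec
              (tp3 Φ (ket s₁))))
          = (ε * (2 * (Real.sqrt 2 : ℂ))⁻¹) •
              swap23 (tp3
                ((((σz ^ ((s₁ + s₃ : Fin 2) : ℕ)) ⊗ₖ
                    (σx ^ ((s₃ : Fin 2) : ℕ) * σz ^ ((s₂ + s₄ : Fin 2) : ℕ))) *
                  CZ * ((1 : Matrix (Fin 2) (Fin 2) ℂ) ⊗ₖ Hgate)).mulVec Φ)
                (ket s₄))) ∧
        (∑ p : (Fin 2 × Fin 2) × Fin 2,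
            ‖((ε * (2 * (Real.sqrt 2 : ℂ))⁻¹) •
              swap23 (tp3
                ((((σz ^ ((s₁ + s₃ : Fin 2) : ℕ)) ⊗ₖ
                    (σx ^ ((s₃ : Fin 2) : ℕ) * σz ^ ((s₂ + s₄ : Fin 2) : ℕ))) *
                  CZ * ((1 : Matrix (Fin 2) (Fin 2) ℂ) ⊗ₖ Hgate)).mulVec Φ)
                (ket s₄))) p‖ ^ 2
          = (∑ q : Fin 2 × Fin 2, ‖Φ q‖ ^ 2) / 8) := by
  refine ⟨(-1) ^ ((s₂ * (s₁ + s₃) : Fin 2) : ℕ), neg_one_pow_eq_or ℂ _, fun Φ => ⟨?_, ?_⟩⟩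
  · ext ⟨⟨a, b⟩, c⟩
    rw [measure_Zb_apply, measure_ZcXb_apply, measure_ZaXc_apply, measure_ZaXc_apply]
    simp only [Pi.smul_apply, swap23, tp3, pauli_CZ_H_apply, smul_eq_mul, ket]
    have h (e p x y : ℂ) : e * (2 * (Real.sqrt 2 : ℂ))⁻¹ * (p * (Real.sqrt 2 : ℂ)⁻¹ * x * y) =
        4⁻¹ * (e * p * x * y) := by
      have h₂ : ((Real.sqrt 2 : ℂ))⁻¹ ^ 2 = 2⁻¹ := by
        rw [inv_pow, ← Complex.ofReal_pow, Real.sq_sqrt zero_le_two, Complex.ofReal_ofNat]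
      linear_combination (2⁻¹ * e * p * x * y) * h₂
    rw [h]
    by_cases hb : b = s₄
    · subst hb
      fin_cases s₁ <;> fin_cases s₂ <;> fin_cases s₃ <;> fin_cases b <;> fin_cases a <;>
        fin_cases c <;> simp <;> ring
    · simp [hb]
  · simp only [Pi.smul_apply, smul_eq_mul, norm_mul, mul_pow, ← Finset.mul_sum,
      sum_norm_sq_swap23_tp3_ket, sum_norm_sq_pauli_CZ_H]
    have h : (Real.sqrt 2) ^ 2 = 2 := Real.sq_sqrt zero_le_two
    simp [mul_pow, h]
    ring
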